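/- arXiv:1904.04011 — 5 statements merged into one kernel-verified Lean document; each statement's English description precedes it below -/
import Mathlib

section
/- Generalized Lax–Milgram (Babuška) theorem: Let H be a complex Hilbert space and b : H × H → ℂ a bounded sesquilinear form (linear in the first argument, conjugate-linear in the second), so that for some M ≥ 0 one has |b(u,v)| ≤ M·‖u‖·‖v‖ for all u, v ∈ H. Assume the inf-sup condition holds: α := inf over nonzero u of (sup over nonzero v of |b(u,v)|/(‖u‖·‖v‖)) satisfies α > 0; and assume the transposed inf-sup condition: for every nonzero v ∈ H, sup over nonzero u of |b(u,v)|/‖u‖ is strictly positive. Then for every bounded conjugate-linear functional G : H → ℂ there exists a unique u ∈ H such that b(u,v) = G(v) for all v ∈ H, and this u satisfies ‖u‖ ≤ α⁻¹·‖G‖, where ‖G‖ = sup over nonzero v of |G(v)|/‖v‖. -/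
open scoped ComplexConjugate

open scoped InnerProductSpace

/-- Fréchet–Riesz for bounded conjugate-linear functionals. -/
theorem exists_inner_eq_of_conj_linear
    {H : Type*} [NormedAddCommGroup H] [InnerProductSpace ℂ H] [CompleteSpace H]
    (G : H → ℂ) (hG_cont : Continuous G)
    (hG_add : ∀ v w : H, G (v + w) = G v + G w)
    (hG_smul : ∀ (c : ℂ) (v : H), G (c • v) = conj c * G v) :
    ∃ g : H, ∀ v : H, ⟪v, g⟫_ℂ = G v := by
  let F : StrongDual ℂ H :=
    { toFun := fun v => conj (G v)
      map_add' := by simp [hG_add]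
      map_smul' := by simp [hG_smul]
      cont := Complex.continuous_conj.comp hG_cont }
  refine ⟨(InnerProductSpace.toDual ℂ H).symm F, fun v => ?_⟩
  rw [← inner_conj_symm, InnerProductSpace.toDual_symm_apply]
  exact Complex.conj_conj (G v)

/-- A bounded sesquilinear form is represented by a continuous linear operator. -/
theorem exists_continuousLinearMap_inner_eq
    {H : Type*} [NormedAddCommGroup H] [InnerProductSpace ℂ H] [CompleteSpace H]
    (b : H → H → ℂ) (M : ℝ)
    (hb_add₁ : ∀ u u' v : H, b (u + u') v = b u v + b u' v)
    (hb_smul₁ : ∀ (c : ℂ) (u v : H), b (c • u) v = c * b u v)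
    (hb_add₂ : ∀ u v v' : H, b u (v + v') = b u v + b u v')
    (hb_smul₂ : ∀ (c : ℂ) (u v : H), b u (c • v) = conj c * b u v)
    (hb_bound : ∀ u v : H, ‖b u v‖ ≤ M * ‖u‖ * ‖v‖) :
    ∃ A : H →L[ℂ] H, ∀ u v : H, ⟪v, A u⟫_ℂ = b u v := by
  let B : H →L⋆[ℂ] H →L[ℂ] ℂ := LinearMap.mkContinuous₂
    (LinearMap.mk₂'ₛₗ (starRingEnd ℂ) (RingHom.id ℂ) (fun u v => conj (b u v))
      (by simp [hb_add₁]) (by simp [hb_smul₁]) (by simp [hb_add₂]) (by simp [hb_smul₂]))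
    M (by simpa using hb_bound)
  refine ⟨InnerProductSpace.continuousLinearMapOfBilin B, fun u v => ?_⟩
  rw [← inner_conj_symm, InnerProductSpace.continuousLinearMapOfBilin_apply]
  exact Complex.conj_conj (b u v)

/-- A continuous linear operator that is bounded below and whose range has trivial orthogonal
complement is bijective. -/
theorem ContinuousLinearMap.bijective_of_bounded_below
    {H : Type*} [NormedAddCommGroup H] [InnerProductSpace ℂ H] [CompleteSpace H]
    (A : H →L[ℂ] H) {α : ℝ} (hα : 0 < α) (hA : ∀ u, α * ‖u‖ ≤ ‖A u‖)
    (hA_dense : ∀ v : H, (∀ u, ⟪v, A u⟫_ℂ = 0) → v = 0) :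
    Function.Bijective A := by
  have hanti : AntilipschitzWith (Real.toNNReal α⁻¹) A := by
    refine A.antilipschitz_of_bound fun u => ?_
    rw [Real.coe_toNNReal _ (inv_nonneg.2 hα.le), ← div_eq_inv_mul, le_div_iff₀' hα]
    exact hA u
  refine ⟨hanti.injective, ?_⟩
  have hclosed : IsClosed (A.range : Set H) := by
    rw [LinearMap.coe_range]
    exact hanti.isClosed_range A.uniformContinuous
  have := hclosed.completeSpace_coe
  have htop : A.range = ⊤ := by
    rw [← Submodule.orthogonal_eq_bot_iff, Submodule.eq_bot_iff]
    intro v hv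
    exact hA_dense v fun u => (Submodule.mem_orthogonal' _ _).1 hv _ ⟨u, rfl⟩
  exact LinearMap.range_eq_top.1 htop

/-- The inf-sup constant, multiplied by `‖u‖`, is a lower bound for the dual norm of `b u`. -/
theorem iInf_iSup_mul_norm_le {H : Type*} [NormedAddCommGroup H] (b : H → H → ℂ) (u : H) :
    (⨅ u : {u : H // u ≠ 0}, ⨆ v : {v : H // v ≠ 0}, ‖b u.1 v.1‖ / (‖u.1‖ * ‖v.1‖)) * ‖u‖ ≤
      ⨆ v : {v : H // v ≠ 0}, ‖b u v.1‖ / ‖v.1‖ := by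
  by_cases hu : u = 0
  · simpa [hu] using Real.iSup_nonneg fun v : {v : H // v ≠ 0} =>
      div_nonneg (norm_nonneg (b 0 v.1)) (norm_nonneg v.1)
  have hu' : 0 < ‖u‖ := norm_pos_iff.2 hu
  rw [← le_div_iff₀ hu']
  refine (ciInf_le ⟨0, ?_⟩ (⟨u, hu⟩ : {u : H // u ≠ 0})).trans_eq ?_
  · rintro _ ⟨w, rfl⟩
    exact Real.iSup_nonneg fun v => by positivity
  · rw [div_eq_mul_inv, Real.iSup_mul_of_nonneg (inv_nonneg.2 hu'.le)]
    congr 1 with v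
    rw [← div_eq_mul_inv, div_div, mul_comm]

/-- **Generalized Lax–Milgram (Babuška) theorem.** Let `H` be a complex Hilbert space and
`b : H × H → ℂ` a bounded sesquilinear form (linear in the first argument, conjugate-linear in
the second), with `|b(u,v)| ≤ M‖u‖‖v‖`.  Assume the inf-sup condition
`α := inf_{u ≠ 0} sup_{v ≠ 0} |b(u,v)|/(‖u‖‖v‖) > 0` and the transposed inf-sup condition
(`sup_{u ≠ 0} |b(u,v)|/‖u‖ > 0` for every `v ≠ 0`).  Then for every bounded conjugate-linear
functional `G : H → ℂ` there is a unique `u` with `b(u,v) = G(v)` for all `v`, and this `u`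
satisfies `‖u‖ ≤ α⁻¹‖G‖` where `‖G‖ = sup_{v ≠ 0} |G(v)|/‖v‖`. -/
theorem generalized_lax_milgram
    {H : Type*} [NormedAddCommGroup H] [InnerProductSpace ℂ H] [CompleteSpace H]
    (b : H → H → ℂ) (M : ℝ)
    (hb_add₁ : ∀ u u' v : H, b (u + u') v = b u v + b u' v)
    (hb_smul₁ : ∀ (c : ℂ) (u v : H), b (c • u) v = c * b u v)
    (hb_add₂ : ∀ u v v' : H, b u (v + v') = b u v + b u v')
    (hb_smul₂ : ∀ (c : ℂ) (u v : H), b u (c • v) = conj c * b u v)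
    (hb_bound : ∀ u v : H, ‖b u v‖ ≤ M * ‖u‖ * ‖v‖)
    (α : ℝ)
    (hα : α = ⨅ u : {u : H // u ≠ 0}, ⨆ v : {v : H // v ≠ 0},
      ‖b u.1 v.1‖ / (‖u.1‖ * ‖v.1‖))
    (hα_pos : 0 < α)
    (h_transposed : ∀ v : H, v ≠ 0 →
      0 < ⨆ u : {u : H // u ≠ 0}, ‖b u.1 v‖ / ‖u.1‖)
    (G : H → ℂ) (hG_cont : Continuous G)
    (hG_add : ∀ v w : H, G (v + w) = G v + G w)
    (hG_smul : ∀ (c : ℂ) (v : H), G (c • v) = conj c * G v)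
    (normG : ℝ)
    (hnormG : normG = ⨆ v : {v : H // v ≠ 0}, ‖G v.1‖ / ‖v.1‖) :
    (∃! u : H, ∀ v : H, b u v = G v) ∧
      ∀ u : H, (∀ v : H, b u v = G v) → ‖u‖ ≤ α⁻¹ * normG := by
  obtain ⟨A, hA⟩ :=
    exists_continuousLinearMap_inner_eq b M hb_add₁ hb_smul₁ hb_add₂ hb_smul₂ hb_bound
  obtain ⟨g, hg⟩ := exists_inner_eq_of_conj_linear G hG_cont hG_add hG_smul
  have hα_le : ∀ u : H, α * ‖u‖ ≤ ⨆ v : {v : H // v ≠ 0}, ‖b u v.1‖ / ‖v.1‖ := fun u =>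
    hα ▸ iInf_iSup_mul_norm_le b u
  have hA_below : ∀ u : H, α * ‖u‖ ≤ ‖A u‖ := fun u => by
    refine (hα_le u).trans (Real.iSup_le (fun v => ?_) (norm_nonneg _))
    rw [div_le_iff₀ (norm_pos_iff.2 v.2), ← hA, mul_comm]
    exact norm_inner_le_norm _ _
  have hA_dense : ∀ v : H, (∀ u, ⟪v, A u⟫_ℂ = 0) → v = 0 := fun v hv => by
    by_contra hv0
    simpa [← hA, hv] using h_transposed v hv0
  have hsolve : ∀ u : H, (∀ v : H, b u v = G v) ↔ A u = g := fun u => by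
    simp_rw [← hA, ← hg]
    exact ⟨ext_inner_left ℂ, fun h v => by rw [h]⟩
  refine ⟨?_, fun u hu => ?_⟩
  · simp_rw [hsolve]
    exact (A.bijective_of_bounded_below hα_pos hA_below hA_dense).existsUnique g
  · rw [← div_eq_inv_mul, le_div_iff₀' hα_pos, hnormG]
    simpa only [hu] using hα_le u
end

section
/- Friedrichs inequality with boundary term over a Lipschitz graph: Suppose in addition that f₋ ≤ f(x̃) ≤ H for all x̃ ∈ ℝ^d, for some reals f₋ and H, and set S_H = {(x̃, x_n) : f(x̃) < x_n < H}. Then for every smooth compactly supported w : ℝ^{d+1} → ℂ and every ζ > 0, ∫_{S_H} |w(x)|² dx ≤ (1+ζ)·((H − f₋)²/2)·∫_{S_H} |∂w/∂x_n(x)|² dx + (1 + 1/ζ)·(H − f₋)·∫_{ℝ^d} |w(x̃, f(x̃))|² J_f(x̃) dx̃. -/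
open MeasureTheory

/-- Cauchy-Schwarz against the constant function on an interval. -/
theorem sq_intervalIntegral_le_mul_intervalIntegral_sq {a t : ℝ} (hat : a ≤ t) {u : ℝ → ℝ}
    (hu : Continuous u) :
    (∫ s in a..t, u s) ^ 2 ≤ (t - a) * ∫ s in a..t, u s ^ 2 := by
  rcases hat.eq_or_lt with rfl | hlt
  · simp
  have hT : 0 < t - a := sub_pos.2 hlt
  set c : ℝ := (∫ s in a..t, u s) / (t - a) with hc
  have h0 : 0 ≤ ∫ s in a..t, (u s - c) ^ 2 :=
    intervalIntegral.integral_nonneg hat fun s _ => sq_nonneg _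
  have h1 : ∫ s in a..t, (u s - c) ^ 2
      = (∫ s in a..t, u s ^ 2) - 2 * c * (∫ s in a..t, u s) + (t - a) * c ^ 2 := by
    have : ∀ s, (u s - c) ^ 2 = u s ^ 2 - 2 * c * u s + c ^ 2 := fun s => by ring
    simp_rw [this]
    rw [intervalIntegral.integral_add, intervalIntegral.integral_sub,
      intervalIntegral.integral_const_mul, intervalIntegral.integral_const, smul_eq_mul]
    all_goals exact Continuous.intervalIntegrable (by fun_prop) _ _
  have h2 : (∫ s in a..t, u s) = c * (t - a) := by rw [hc]; field_simp
  rw [h1, h2] at h0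
  rw [h2]
  nlinarith [mul_nonneg hT.le h0]

theorem sq_add_le_of_pos {ζ : ℝ} (hζ : 0 < ζ) (p q : ℝ) :
    (p + q) ^ 2 ≤ (1 + ζ) * q ^ 2 + (1 + 1 / ζ) * p ^ 2 := by
  have h : (1 + ζ) * q ^ 2 + (1 + 1 / ζ) * p ^ 2 - (p + q) ^ 2 = (p - ζ * q) ^ 2 / ζ := by
    field_simp
    ring
  have : 0 ≤ (p - ζ * q) ^ 2 / ζ := by positivity
  linarith

/-- One-dimensional Friedrichs inequality with a boundary term at the left endpoint. -/
theorem setIntegral_Ioo_norm_sq_le {a b : ℝ} (hab : a ≤ b) {g g' : ℝ → ℂ}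
    (hg : ∀ t, HasDerivAt g (g' t) t) (hg' : Continuous g') {ζ : ℝ} (hζ : 0 < ζ) :
    ∫ t in Set.Ioo a b, ‖g t‖ ^ 2
      ≤ (1 + ζ) * ((b - a) ^ 2 / 2) * (∫ t in Set.Ioo a b, ‖g' t‖ ^ 2)
        + (1 + 1 / ζ) * (b - a) * ‖g a‖ ^ 2 := by
  have hgc : Continuous g := continuous_iff_continuousAt.2 fun t => (hg t).continuousAt
  simp only [← integral_Ioc_eq_integral_Ioo, ← intervalIntegral.integral_of_le hab]
  set Q := ∫ t in a..b, ‖g' t‖ ^ 2 with hQ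
  have key : ∀ t ∈ Set.Icc a b,
      ‖g t‖ ^ 2 ≤ (1 + ζ) * ((t - a) * Q) + (1 + 1 / ζ) * ‖g a‖ ^ 2 := by
    rintro t ⟨hat, htb⟩
    have hftc : ∫ s in a..t, g' s = g t - g a :=
      intervalIntegral.integral_eq_sub_of_hasDerivAt (fun s _ => hg s)
        (hg'.intervalIntegrable _ _)
    have h1 : ‖g t‖ ≤ ‖g a‖ + ∫ s in a..t, ‖g' s‖ := by
      have h := intervalIntegral.norm_integral_le_integral_norm (μ := volume) (f := g') hat
      rw [hftc] at h
      have := norm_le_norm_add_norm_sub' (g t) (g a)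
      linarith
    have h2 := sq_intervalIntegral_le_mul_intervalIntegral_sq hat hg'.norm
    have h3 : ∫ s in a..t, ‖g' s‖ ^ 2 ≤ Q :=
      intervalIntegral.integral_mono_interval le_rfl hat htb
        (Filter.Eventually.of_forall fun s => by positivity)
        (Continuous.intervalIntegrable (by fun_prop) _ _)
    calc ‖g t‖ ^ 2 ≤ (‖g a‖ + ∫ s in a..t, ‖g' s‖) ^ 2 := by gcongr
      _ ≤ (1 + ζ) * (∫ s in a..t, ‖g' s‖) ^ 2 + (1 + 1 / ζ) * ‖g a‖ ^ 2 :=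
        sq_add_le_of_pos hζ _ _
      _ ≤ _ := by
        have : (∫ s in a..t, ‖g' s‖) ^ 2 ≤ (t - a) * Q :=
          h2.trans (mul_le_mul_of_nonneg_left h3 (sub_nonneg.2 hat))
        gcongr
  have hmono := intervalIntegral.integral_mono_on (μ := volume) hab
    (Continuous.intervalIntegrable (by fun_prop) _ _)
    (Continuous.intervalIntegrable (by fun_prop) _ _) key
  refine hmono.trans_eq ?_
  have hlin : ∫ t in a..b, (t - a) = (b - a) ^ 2 / 2 := by
    rw [intervalIntegral.integral_comp_sub_right (fun t => t) a, integral_id]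
    ring
  rw [intervalIntegral.integral_add, intervalIntegral.integral_const_mul,
    intervalIntegral.integral_mul_const, hlin, intervalIntegral.integral_const, smul_eq_mul]
  · ring
  all_goals exact Continuous.intervalIntegrable (by fun_prop) _ _

theorem measurableSet_graph_lt_lt {X : Type*} [MeasurableSpace X] {f : X → ℝ} (hf : Measurable f) (b : ℝ) :
    MeasurableSet {p : X × ℝ | f p.1 < p.2 ∧ p.2 < b} :=
  (measurableSet_lt (hf.comp measurable_fst) measurable_snd).inter
    (measurableSet_lt measurable_snd measurable_const)

theorem indicator_graph_lt_lt_mk {X : Type*} (f : X → ℝ) (b : ℝ) (F : X × ℝ → ℝ) (x : X) :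
    (fun t => {p : X × ℝ | f p.1 < p.2 ∧ p.2 < b}.indicator F (x, t))
      = (Set.Ioo (f x) b).indicator fun t => F (x, t) := by
  ext t
  simp [Set.indicator, Set.mem_Ioo]

/-- Fubini on the region between a graph and a horizontal hyperplane. -/
theorem setIntegral_graph_lt_lt {X : Type*} [MeasurableSpace X] {μ : Measure X} [SFinite μ]
    {f : X → ℝ} (hf : Measurable f) (b : ℝ) {F : X × ℝ → ℝ}
    (hF : Integrable F (μ.prod volume)) :
    ∫ p in {p : X × ℝ | f p.1 < p.2 ∧ p.2 < b}, F p ∂(μ.prod volume)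
      = ∫ x, (∫ t in Set.Ioo (f x) b, F (x, t)) ∂μ := by
  have hS := measurableSet_graph_lt_lt hf b
  rw [← integral_indicator hS, integral_prod _ (hF.indicator hS)]
  simp_rw [indicator_graph_lt_lt_mk, integral_indicator measurableSet_Ioo]

theorem integrable_setIntegral_graph_lt_lt {X : Type*} [MeasurableSpace X] {μ : Measure X}
    {f : X → ℝ} (hf : Measurable f) (b : ℝ)
    {F : X × ℝ → ℝ} (hF : Integrable F (μ.prod volume)) :
    Integrable (fun x => ∫ t in Set.Ioo (f x) b, F (x, t)) μ := by
  have h := (hF.indicator (measurableSet_graph_lt_lt hf b)).integral_prod_left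
  simpa only [indicator_graph_lt_lt_mk, integral_indicator measurableSet_Ioo] using h

/-- The trace of a compactly supported function on a Lipschitz graph has integrable square with
respect to surface measure. -/
theorem integrable_norm_sq_graph_mul_sqrt {d : ℕ} {K : NNReal}
    {f : EuclideanSpace ℝ (Fin d) → ℝ} (hf : LipschitzWith K f)
    {w : EuclideanSpace ℝ (Fin d) × ℝ → ℂ} (hw : Continuous w) (hw' : HasCompactSupport w) :
    Integrable fun x => ‖w (x, f x)‖ ^ 2 * Real.sqrt (1 + ‖fderiv ℝ f x‖ ^ 2) := by
  have hc : Continuous fun x => ‖w (x, f x)‖ ^ 2 :=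
    ((hw.comp (continuous_id.prodMk hf.continuous)).norm).pow 2
  have hs : HasCompactSupport fun x => ‖w (x, f x)‖ ^ 2 := by
    refine HasCompactSupport.intro (hw'.isCompact.image continuous_fst) fun x hx => ?_
    have : w (x, f x) = 0 := by
      by_contra h
      exact hx ⟨_, subset_tsupport w h, rfl⟩
    simp [this]
  refine (hc.integrable_of_hasCompactSupport hs).mul_bdd (c := Real.sqrt (1 + (K : ℝ) ^ 2))
    ?_ (Filter.Eventually.of_forall fun x => ?_)
  · exact ((((measurable_fderiv ℝ f).norm.pow_const 2).const_add 1).sqrt).aestronglyMeasurable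
  · rw [Real.norm_of_nonneg (Real.sqrt_nonneg _)]
    have := norm_fderiv_le_of_lipschitz ℝ hf (x₀ := x)
    gcongr

/-- **Friedrichs inequality with boundary term over a Lipschitz graph.** Let `f : ℝ^d → ℝ` be
Lipschitz with constant `L` and `f₋ ≤ f ≤ H`, and let
`S_H = {(x̃,x_n) : f(x̃) < x_n < H}`.  Then for every smooth compactly supported
`w : ℝ^{d+1} → ℂ` and every `ζ > 0`,
`∫_{S_H} |w|² ≤ (1+ζ)((H−f₋)²/2)∫_{S_H} |∂w/∂x_n|²
  + (1+1/ζ)(H−f₋)∫_{ℝ^d} |w(x̃,f(x̃))|² J_f(x̃) dx̃`,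
where `J_f = √(1+|∇f|²)` is the surface-measure Jacobian. -/
theorem friedrichs_inequality_with_boundary_term
    (d : ℕ) (hd : 1 ≤ d) (L : ℝ) (hL : 0 < L)
    (f : EuclideanSpace ℝ (Fin d) → ℝ)
    (hf : ∀ x y : EuclideanSpace ℝ (Fin d), |f x - f y| ≤ L * ‖x - y‖)
    (fminus H : ℝ) (hbounds : ∀ x : EuclideanSpace ℝ (Fin d), fminus ≤ f x ∧ f x ≤ H)
    (w : EuclideanSpace ℝ (Fin d) × ℝ → ℂ)
    (hw : ContDiff ℝ (⊤ : ℕ∞) w) (hw' : HasCompactSupport w)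
    (ζ : ℝ) (hζ : 0 < ζ) :
    ∫ p in {p : EuclideanSpace ℝ (Fin d) × ℝ | f p.1 < p.2 ∧ p.2 < H}, ‖w p‖ ^ 2
      ≤ (1 + ζ) * ((H - fminus) ^ 2 / 2) *
          (∫ p in {p : EuclideanSpace ℝ (Fin d) × ℝ | f p.1 < p.2 ∧ p.2 < H},
            ‖fderiv ℝ w p ((0 : EuclideanSpace ℝ (Fin d)), (1 : ℝ))‖ ^ 2)
        + (1 + 1 / ζ) * (H - fminus) *
          ∫ x : EuclideanSpace ℝ (Fin d),
            ‖w (x, f x)‖ ^ 2 * Real.sqrt (1 + ‖fderiv ℝ f x‖ ^ 2) := by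
  have hlip : LipschitzWith L.toNNReal f :=
    LipschitzWith.of_dist_le_mul fun x y => by
      rw [Real.coe_toNNReal L hL.le, dist_eq_norm, dist_eq_norm]
      exact hf x y
  have hfm : Measurable f := hlip.continuous.measurable
  have hdc : Continuous fun p => fderiv ℝ w p ((0 : EuclideanSpace ℝ (Fin d)), (1 : ℝ)) :=
    (hw.continuous_fderiv (by simp)).clm_apply continuous_const
  have hI₀ : Integrable (fun p => ‖w p‖ ^ 2) := by
    refine (hw.continuous.norm.pow 2).integrable_of_hasCompactSupport ?_
    exact hw'.mono fun p hp h => hp (by simp [h])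
  have hI₁ : Integrable
      (fun p => ‖fderiv ℝ w p ((0 : EuclideanSpace ℝ (Fin d)), (1 : ℝ))‖ ^ 2) := by
    refine (hdc.norm.pow 2).integrable_of_hasCompactSupport ?_
    exact (hw'.fderiv (𝕜 := ℝ)).mono fun p hp h => hp (by simp [h])
  have hI₂ := integrable_norm_sq_graph_mul_sqrt hlip hw.continuous hw'
  rw [Measure.volume_eq_prod] at hI₀ hI₁ ⊢
  rw [setIntegral_graph_lt_lt hfm H hI₀, setIntegral_graph_lt_lt hfm H hI₁,
    ← integral_const_mul, ← integral_const_mul, ← integral_add]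
  rotate_left
  · exact (integrable_setIntegral_graph_lt_lt hfm H hI₁).const_mul _
  · exact hI₂.const_mul _
  refine integral_mono (integrable_setIntegral_graph_lt_lt hfm H hI₀)
    (((integrable_setIntegral_graph_lt_lt hfm H hI₁).const_mul _).add (hI₂.const_mul _))
    fun x => ?_
  obtain ⟨hlow, hup⟩ := hbounds x
  have hderiv : ∀ t, HasDerivAt (fun s => w (x, s))
      (fderiv ℝ w (x, t) ((0 : EuclideanSpace ℝ (Fin d)), (1 : ℝ))) t := fun t =>
    ((hw.differentiable (by simp)) (x, t)).hasFDerivAt.comp_hasDerivAt t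
      ((hasDerivAt_const t x).prodMk (hasDerivAt_id t))
  refine (setIntegral_Ioo_norm_sq_le hup hderiv
    (hdc.comp (Continuous.prodMk_right x)) hζ).trans ?_
  have hJ : 1 ≤ Real.sqrt (1 + ‖fderiv ℝ f x‖ ^ 2) :=
    Real.one_le_sqrt.2 (le_add_of_nonneg_right (by positivity))
  have hgap : 0 ≤ H - f x := sub_nonneg.2 hup
  have hint : 0 ≤ ∫ t in Set.Ioo (f x) H,
      ‖fderiv ℝ w (x, t) ((0 : EuclideanSpace ℝ (Fin d)), (1 : ℝ))‖ ^ 2 :=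
    integral_nonneg fun t => by positivity
  have htr : ‖w (x, f x)‖ ^ 2 ≤ ‖w (x, f x)‖ ^ 2 * Real.sqrt (1 + ‖fderiv ℝ f x‖ ^ 2) :=
    le_mul_of_one_le_right (by positivity) hJ
  have hcoef : 0 ≤ (1 + 1 / ζ) * (H - fminus) :=
    mul_nonneg (by positivity) (hgap.trans (by linarith))
  gcongr
end

section
/- L² trace inequality on a Lipschitz graph: Let k > 0 and μ > 0. Then for every smooth compactly supported u : ℝ^{d+1} → ℂ, k · ∫_{ℝ^d} |u(x̃, f(x̃))|² J_f(x̃) dx̃ ≤ √(1 + L²) · (1 + 1/(μk)) · ∫_Ω ( k²·|u(x)|² + |∇u(x)|² ) dx, where Ω = {(x̃, f(x̃) + t) : x̃ ∈ ℝ^d, 0 < t < μ} is the one-sided collar of height μ above the graph of f. -/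
open MeasureTheory

/-- One-dimensional trace inequality: the value of `v` at an endpoint is controlled by its
`H¹` energy on an interval of length `μ`. -/
theorem mul_sq_norm_le_intervalIntegral {E : Type*} [NormedAddCommGroup E] [InnerProductSpace ℝ E]
    {v v' : ℝ → E} (hv : ∀ t, HasDerivAt v (v' t) t) (hv' : Continuous v')
    {k μ : ℝ} (hk : 0 < k) (hμ : 0 < μ) (a : ℝ) :
    k * ‖v a‖ ^ 2 ≤
      (1 + 1 / (μ * k)) * ∫ t in a..(a + μ), (k ^ 2 * ‖v t‖ ^ 2 + ‖v' t‖ ^ 2) := by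
  have hvc : Continuous v := continuous_iff_continuousAt.2 fun t => (hv t).continuousAt
  have hw : ∀ t, HasDerivAt (fun s => ((s - a) / μ - 1) * ‖v s‖ ^ 2)
      (1 / μ * ‖v t‖ ^ 2 + ((t - a) / μ - 1) * (2 * inner ℝ (v t) (v' t))) t := fun t =>
    ((((hasDerivAt_id t).sub_const a).div_const μ).sub_const 1).mul (hv t).norm_sq
  have hwc : Continuous fun t =>
      1 / μ * ‖v t‖ ^ 2 + ((t - a) / μ - 1) * (2 * inner ℝ (v t) (v' t)) := by
    fun_prop
  have hftc := intervalIntegral.integral_eq_sub_of_hasDerivAt (a := a) (b := a + μ)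
    (fun t _ => hw t) (hwc.intervalIntegrable _ _)
  have hval : ‖v a‖ ^ 2 = ∫ t in a..(a + μ),
      (1 / μ * ‖v t‖ ^ 2 + ((t - a) / μ - 1) * (2 * inner ℝ (v t) (v' t))) := by
    rw [hftc]
    simp [hμ.ne']
  rw [hval, ← intervalIntegral.integral_const_mul, ← intervalIntegral.integral_const_mul]
  refine intervalIntegral.integral_mono_on (by linarith)
    ((continuous_const.mul hwc).intervalIntegrable _ _)
    (Continuous.intervalIntegrable (by fun_prop) _ _) fun t ht => ?_
  have hc : |(t - a) / μ - 1| ≤ 1 := by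
    have h0 : 0 ≤ (t - a) / μ := div_nonneg (by linarith [ht.1]) hμ.le
    have h1 : (t - a) / μ ≤ 1 := (div_le_one hμ).2 (by linarith [ht.2])
    rw [abs_le]
    constructor <;> linarith
  have hinner : ((t - a) / μ - 1) * inner ℝ (v t) (v' t) ≤ ‖v t‖ * ‖v' t‖ := by
    refine (le_abs_self _).trans ?_
    rw [abs_mul]
    have := mul_le_mul hc (abs_real_inner_le_norm (v t) (v' t)) (abs_nonneg _) zero_le_one
    linarith
  have hcross : k * (((t - a) / μ - 1) * inner ℝ (v t) (v' t)) ≤ k * (‖v t‖ * ‖v' t‖) :=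
    mul_le_mul_of_nonneg_left hinner hk.le
  have hsplit : (1 + 1 / (μ * k)) * (k ^ 2 * ‖v t‖ ^ 2 + ‖v' t‖ ^ 2) =
      k * (1 / μ * ‖v t‖ ^ 2) + (k ^ 2 * ‖v t‖ ^ 2 + ‖v' t‖ ^ 2)
        + 1 / (μ * k) * ‖v' t‖ ^ 2 := by
    field_simp
    ring
  have hpos : 0 ≤ 1 / (μ * k) * ‖v' t‖ ^ 2 := by positivity
  rw [hsplit]
  nlinarith [sq_nonneg (k * ‖v t‖ - ‖v' t‖)]

/-- **`L²` trace inequality on a Lipschitz graph.** Let `f : ℝ^d → ℝ` be Lipschitz with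
constant `L`.  For every smooth compactly supported `u : ℝ^{d+1} → ℂ`,
`k ∫ |u(x̃,f(x̃))|² J_f(x̃) dx̃ ≤ √(1+L²)(1 + 1/(μk)) ∫_Ω (k²|u|² + |∇u|²)`,
where `Ω = {(x̃, f(x̃)+t) : 0 < t < μ}` is the one-sided collar of height `μ` above the graph
and `J_f = √(1+|∇f|²)`. -/
theorem trace_inequality_lipschitz_graph
    (d : ℕ) (hd : 1 ≤ d) (L : ℝ) (hL : 0 < L) (k μ : ℝ) (hk : 0 < k) (hμ : 0 < μ)
    (f : EuclideanSpace ℝ (Fin d) → ℝ)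
    (hf : ∀ x y : EuclideanSpace ℝ (Fin d), |f x - f y| ≤ L * ‖x - y‖)
    (u : EuclideanSpace ℝ (Fin d) × ℝ → ℂ)
    (hu : ContDiff ℝ (⊤ : ℕ∞) u) (hu' : HasCompactSupport u) :
    k * ∫ x : EuclideanSpace ℝ (Fin d),
        ‖u (x, f x)‖ ^ 2 * Real.sqrt (1 + ‖fderiv ℝ f x‖ ^ 2)
      ≤ Real.sqrt (1 + L ^ 2) * (1 + 1 / (μ * k)) *
        ∫ p in {p : EuclideanSpace ℝ (Fin d) × ℝ | f p.1 < p.2 ∧ p.2 < f p.1 + μ},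
          (k ^ 2 * ‖u p‖ ^ 2 +
            ((∑ i : Fin d, ‖fderiv ℝ u p (EuclideanSpace.single i 1, (0 : ℝ))‖ ^ 2) +
              ‖fderiv ℝ u p ((0 : EuclideanSpace ℝ (Fin d)), (1 : ℝ))‖ ^ 2)) := by
  have hfc : Continuous f :=
    (LipschitzWith.of_dist_le' (K := L) fun x y => by
      simpa [Real.dist_eq, dist_eq_norm] using hf x y).continuous
  have hfd : ∀ x, ‖fderiv ℝ f x‖ ≤ L := fun x => by
    have h := norm_fderiv_le_of_lipschitz ℝ (x₀ := x)
      (LipschitzWith.of_dist_le' (f := f) (K := L) fun x y => by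
        simpa [Real.dist_eq, dist_eq_norm] using hf x y)
    rwa [Real.coe_toNNReal _ hL.le] at h
  set Ω := {p : EuclideanSpace ℝ (Fin d) × ℝ | f p.1 < p.2 ∧ p.2 < f p.1 + μ} with hΩ
  have hΩm : MeasurableSet Ω :=
    ((isOpen_lt (hfc.comp continuous_fst) continuous_snd).inter
      (isOpen_lt continuous_snd ((hfc.comp continuous_fst).add continuous_const))).measurableSet
  set F : EuclideanSpace ℝ (Fin d) × ℝ → ℝ := fun p => k ^ 2 * ‖u p‖ ^ 2 +
      ((∑ i : Fin d, ‖fderiv ℝ u p (EuclideanSpace.single i 1, (0 : ℝ))‖ ^ 2) +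
        ‖fderiv ℝ u p ((0 : EuclideanSpace ℝ (Fin d)), (1 : ℝ))‖ ^ 2) with hF
  have huc : Continuous u := hu.continuous
  have hdu : Continuous (fderiv ℝ u) := hu.continuous_fderiv (by simp)
  have hFc : Continuous F := by fun_prop
  have hFs : HasCompactSupport F := by
    refine hu'.mono' fun p hp => ?_
    by_contra hpu
    have h0 : u p = 0 := image_eq_zero_of_notMem_tsupport hpu
    have h1 : fderiv ℝ u p = 0 :=
      image_eq_zero_of_notMem_tsupport fun h => hpu (tsupport_fderiv_subset ℝ h)
    exact hp (by simp [hF, h0, h1])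
  have hFi : Integrable (Ω.indicator F)
      ((volume : Measure (EuclideanSpace ℝ (Fin d))).prod (volume : Measure ℝ)) :=
    (hFc.integrable_of_hasCompactSupport hFs).indicator hΩm
  have hfiber : ∀ x, ∫ t, Ω.indicator F (x, t) = ∫ t in (f x)..(f x + μ), F (x, t) := fun x => by
    rw [intervalIntegral.integral_of_le (by linarith), integral_Ioc_eq_integral_Ioo,
      ← integral_indicator measurableSet_Ioo]
    rfl
  have htrace : ∀ x, k * ‖u (x, f x)‖ ^ 2 ≤
      (1 + 1 / (μ * k)) * ∫ t, Ω.indicator F (x, t) := fun x => by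
    have hderiv : ∀ t, HasDerivAt (fun s => u (x, s)) (fderiv ℝ u (x, t) (0, 1)) t := fun t =>
      (hu.differentiable (by simp) (x, t)).hasFDerivAt.comp_hasDerivAt t
        ((hasDerivAt_const t x).prodMk (hasDerivAt_id t))
    refine (mul_sq_norm_le_intervalIntegral hderiv (by fun_prop) hk hμ (f x)).trans ?_
    rw [hfiber]
    refine mul_le_mul_of_nonneg_left ?_ (by positivity)
    refine intervalIntegral.integral_mono_on (by linarith)
      (Continuous.intervalIntegrable (by fun_prop) _ _)
      (Continuous.intervalIntegrable (by fun_prop) _ _) fun t _ => ?_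
    have : 0 ≤ ∑ i : Fin d, ‖fderiv ℝ u (x, t) (EuclideanSpace.single i 1, (0 : ℝ))‖ ^ 2 := by
      positivity
    simp only [hF]
    linarith
  rw [← integral_indicator hΩm, Measure.volume_eq_prod, integral_prod _ hFi,
    ← integral_const_mul, ← integral_const_mul]
  refine integral_mono_of_nonneg (.of_forall fun x => by positivity)
    (hFi.integral_prod_left.const_mul _) (.of_forall fun x => ?_)
  have hJ : √(1 + ‖fderiv ℝ f x‖ ^ 2) ≤ √(1 + L ^ 2) :=
    Real.sqrt_le_sqrt (by gcongr; exact hfd x)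
  calc k * (‖u (x, f x)‖ ^ 2 * √(1 + ‖fderiv ℝ f x‖ ^ 2))
      = √(1 + ‖fderiv ℝ f x‖ ^ 2) * (k * ‖u (x, f x)‖ ^ 2) := by ring
    _ ≤ √(1 + L ^ 2) * ((1 + 1 / (μ * k)) * ∫ t, Ω.indicator F (x, t)) :=
      mul_le_mul hJ (htrace x) (by positivity) (by positivity)
    _ = √(1 + L ^ 2) * (1 + 1 / (μ * k)) * ∫ t, Ω.indicator F (x, t) := by ring
end

section
/- Extension by reflection across a smooth Lipschitz graph: Let d ≥ 1, L > 0, k > 0 and H ∈ ℝ. Let f, f* : ℝ^d → ℝ both be Lipschitz with constant L, with f* continuously differentiable, f*(x̃) ≥ f(x̃) for all x̃, and 2f*(x̃) − f(x̃) < H for every x̃. Set S* = {(x̃, x_n) : f*(x̃) < x_n < H} and R = {(x̃, x_n) : f(x̃) < x_n < f*(x̃)}. Given a smooth compactly supported v : ℝ^{d+1} → ℂ, define its reflected extension v_E on R by v_E(x̃, x_n) = v(x̃, 2f*(x̃) − x_n). Then ∫_R ( k²·|v_E(x)|² + |∇v_E(x)|² ) dx ≤ 4·(1 + 4dL²) ·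 ∫_{S*} ( k²·|v(x)|² + |∇v(x)|² ) dx; equivalently, the wavenumber-weighted H¹ norm of v_E on R is at most 2·√(1 + 4dL²) times that of v on S*. -/
open MeasureTheory

/-- Reflection of each vertical line of `E × ℝ` across the graph of `g`. -/
def graphReflection {E : Type*} (g : E → ℝ) (p : E × ℝ) : E × ℝ :=
  (p.1, 2 * g p.1 - p.2)

theorem graphReflection_involutive {E : Type*} (g : E → ℝ) :
    Function.Involutive (graphReflection g) := by
  rintro ⟨x, t⟩
  simp [graphReflection]

theorem measurePreserving_graphReflection {E : Type*} [MeasureSpace E]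
    [SFinite (volume : Measure E)] {g : E → ℝ} (hg : Measurable g) :
    MeasurePreserving (graphReflection g) (volume : Measure (E × ℝ)) volume := by
  refine (MeasurePreserving.id (volume : Measure E)).skew_product
    (g := fun x t => 2 * g x - t) ?_ ?_
  · fun_prop
  · exact ae_of_all _ fun x => (Measure.measurePreserving_sub_left volume (2 * g x)).map_eq

theorem measurableEmbedding_graphReflection {E : Type*} [MeasurableSpace E] {g : E → ℝ}
    (hg : Measurable g) : MeasurableEmbedding (graphReflection g) := by
  have hm : Measurable (graphReflection g) := by unfold graphReflection; fun_prop
  exact (MeasurableEquiv.mk (graphReflection_involutive g).toPerm hm hm).measurableEmbedding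

theorem fderiv_comp_graphReflection {E F : Type*} [NormedAddCommGroup E] [NormedSpace ℝ E]
    [NormedAddCommGroup F] [NormedSpace ℝ F] {g : E → ℝ} {v : E × ℝ → F} {p : E × ℝ}
    (hg : DifferentiableAt ℝ g p.1) (hv : DifferentiableAt ℝ v (graphReflection g p))
    (w : E) (s : ℝ) :
    fderiv ℝ (v ∘ graphReflection g) p (w, s) =
      fderiv ℝ v (graphReflection g p) (w, 2 * fderiv ℝ g p.1 w - s) := by
  have h : HasFDerivAt (graphReflection g)
      ((ContinuousLinearMap.fst ℝ E ℝ).prod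
        ((2 : ℝ) • (fderiv ℝ g p.1).comp (ContinuousLinearMap.fst ℝ E ℝ) -
          ContinuousLinearMap.snd ℝ E ℝ)) p :=
    hasFDerivAt_fst.prodMk
      (((hg.hasFDerivAt.comp p hasFDerivAt_fst).const_mul 2).sub hasFDerivAt_snd)
  rw [(hv.hasFDerivAt.comp p h).fderiv]
  simp

theorem norm_add_smul_sq_le {F : Type*} [NormedAddCommGroup F] [NormedSpace ℝ F]
    (a b : F) {c L : ℝ} (hc : |c| ≤ L) :
    ‖a + (2 * c) • b‖ ^ 2 ≤ 2 * ‖a‖ ^ 2 + 8 * L ^ 2 * ‖b‖ ^ 2 := by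
  have h : ‖a + (2 * c) • b‖ ≤ ‖a‖ + 2 * L * ‖b‖ := by
    refine (norm_add_le _ _).trans ?_
    rw [norm_smul, Real.norm_eq_abs, abs_mul, abs_two]
    gcongr
  calc ‖a + (2 * c) • b‖ ^ 2 ≤ (‖a‖ + 2 * L * ‖b‖) ^ 2 := by gcongr
    _ ≤ _ := by nlinarith [sq_nonneg (‖a‖ - 2 * L * ‖b‖)]

theorem gradient_sq_comp_graphReflection_le {d : ℕ} {L : ℝ}
    {g : EuclideanSpace ℝ (Fin d) → ℝ} {v : EuclideanSpace ℝ (Fin d) × ℝ → ℂ}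
    {p : EuclideanSpace ℝ (Fin d) × ℝ} (hg : DifferentiableAt ℝ g p.1)
    (hgL : ‖fderiv ℝ g p.1‖ ≤ L) (hv : DifferentiableAt ℝ v (graphReflection g p)) :
    (∑ i : Fin d, ‖fderiv ℝ (v ∘ graphReflection g) p (EuclideanSpace.single i 1, (0 : ℝ))‖ ^ 2) +
        ‖fderiv ℝ (v ∘ graphReflection g) p ((0 : EuclideanSpace ℝ (Fin d)), (1 : ℝ))‖ ^ 2 ≤
      2 * (∑ i : Fin d,
          ‖fderiv ℝ v (graphReflection g p) (EuclideanSpace.single i 1, (0 : ℝ))‖ ^ 2) +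
        (1 + 8 * d * L ^ 2) *
          ‖fderiv ℝ v (graphReflection g p)
            ((0 : EuclideanSpace ℝ (Fin d)), (1 : ℝ))‖ ^ 2 := by
  set D := fderiv ℝ v (graphReflection g p)
  set b := D ((0 : EuclideanSpace ℝ (Fin d)), (1 : ℝ))
  have hvert : fderiv ℝ (v ∘ graphReflection g) p (0, 1) = -b := by
    rw [fderiv_comp_graphReflection hg hv, ← map_neg]
    simp [D]
  have hhor : ∀ i : Fin d,
      ‖fderiv ℝ (v ∘ graphReflection g) p (EuclideanSpace.single i 1, (0 : ℝ))‖ ^ 2 ≤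
        2 * ‖D (EuclideanSpace.single i 1, (0 : ℝ))‖ ^ 2 + 8 * L ^ 2 * ‖b‖ ^ 2 := by
    intro i
    have hc : |fderiv ℝ g p.1 (EuclideanSpace.single i 1)| ≤ L := by
      simpa using ((fderiv ℝ g p.1).le_opNorm (EuclideanSpace.single i 1)).trans
        (mul_le_mul_of_nonneg_right hgL (norm_nonneg _))
    have hsplit : fderiv ℝ (v ∘ graphReflection g) p (EuclideanSpace.single i 1, (0 : ℝ)) =
        D (EuclideanSpace.single i 1, (0 : ℝ)) +
          (2 * fderiv ℝ g p.1 (EuclideanSpace.single i 1)) • b := by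
      rw [fderiv_comp_graphReflection hg hv, ← map_smul, ← map_add]
      simp [D]
    rw [hsplit]
    exact norm_add_smul_sq_le _ b hc
  rw [hvert, norm_neg]
  have hsum := Finset.sum_le_sum fun i (_ : i ∈ Finset.univ) => hhor i
  rw [Finset.sum_add_distrib, ← Finset.mul_sum] at hsum
  simp only [Finset.sum_const, Finset.card_univ, Fintype.card_fin, nsmul_eq_mul] at hsum
  linarith

theorem integrable_weighted_energy {d : ℕ} (k : ℝ) {v : EuclideanSpace ℝ (Fin d) × ℝ → ℂ}
    (hv : ContDiff ℝ 1 v) (hv' : HasCompactSupport v) :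
    Integrable fun p : EuclideanSpace ℝ (Fin d) × ℝ =>
      k ^ 2 * ‖v p‖ ^ 2 +
        ((∑ i : Fin d, ‖fderiv ℝ v p (EuclideanSpace.single i 1, (0 : ℝ))‖ ^ 2) +
          ‖fderiv ℝ v p ((0 : EuclideanSpace ℝ (Fin d)), (1 : ℝ))‖ ^ 2) := by
  have hc : Continuous (fderiv ℝ v) := hv.continuous_fderiv one_ne_zero
  have hc' := hv.continuous
  refine Continuous.integrable_of_hasCompactSupport (by fun_prop) ?_
  refine HasCompactSupport.of_support_subset_isCompact hv' fun p hp => ?_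
  by_contra hmem
  refine hp ?_
  simp [image_eq_zero_of_notMem_tsupport hmem,
    image_eq_zero_of_notMem_tsupport fun h => hmem (tsupport_fderiv_subset ℝ h)]

/-- **Extension by reflection across a smooth Lipschitz graph.** Let `f, f* : ℝ^d → ℝ` be
Lipschitz with constant `L`, with `f*` continuously differentiable, `f* ≥ f`, and
`2f* − f < H`.  Let `S* = {f*(x̃) < x_n < H}` and `R = {f(x̃) < x_n < f*(x̃)}`.  For a smooth
compactly supported `v`, the reflected extension `v_E(x̃,x_n) = v(x̃, 2f*(x̃) − x_n)` satisfies
`∫_R (k²|v_E|² + |∇v_E|²) ≤ 4(1+4dL²) ∫_{S*} (k²|v|² + |∇v|²)`. -/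
theorem reflection_extension_bound
    (d : ℕ) (hd : 1 ≤ d) (L k H : ℝ) (hL : 0 < L) (hk : 0 < k)
    (f fstar : EuclideanSpace ℝ (Fin d) → ℝ)
    (hf : ∀ x y : EuclideanSpace ℝ (Fin d), |f x - f y| ≤ L * ‖x - y‖)
    (hfstar : ∀ x y : EuclideanSpace ℝ (Fin d), |fstar x - fstar y| ≤ L * ‖x - y‖)
    (hfstarC1 : ContDiff ℝ 1 fstar)
    (hge : ∀ x : EuclideanSpace ℝ (Fin d), f x ≤ fstar x)
    (hlt : ∀ x : EuclideanSpace ℝ (Fin d), 2 * fstar x - f x < H)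
    (v : EuclideanSpace ℝ (Fin d) × ℝ → ℂ)
    (hv : ContDiff ℝ (⊤ : ℕ∞) v) (hv' : HasCompactSupport v)
    (vE : EuclideanSpace ℝ (Fin d) × ℝ → ℂ)
    (hvE : ∀ (x : EuclideanSpace ℝ (Fin d)) (t : ℝ), vE (x, t) = v (x, 2 * fstar x - t)) :
    ∫ p in {p : EuclideanSpace ℝ (Fin d) × ℝ | f p.1 < p.2 ∧ p.2 < fstar p.1},
        (k ^ 2 * ‖vE p‖ ^ 2 +
          ((∑ i : Fin d, ‖fderiv ℝ vE p (EuclideanSpace.single i 1, (0 : ℝ))‖ ^ 2) +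
            ‖fderiv ℝ vE p ((0 : EuclideanSpace ℝ (Fin d)), (1 : ℝ))‖ ^ 2))
      ≤ 4 * (1 + 4 * d * L ^ 2) *
        ∫ p in {p : EuclideanSpace ℝ (Fin d) × ℝ | fstar p.1 < p.2 ∧ p.2 < H},
          (k ^ 2 * ‖v p‖ ^ 2 +
            ((∑ i : Fin d, ‖fderiv ℝ v p (EuclideanSpace.single i 1, (0 : ℝ))‖ ^ 2) +
              ‖fderiv ℝ v p ((0 : EuclideanSpace ℝ (Fin d)), (1 : ℝ))‖ ^ 2)) := by
  obtain rfl : vE = v ∘ graphReflection fstar := funext fun p => hvE p.1 p.2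
  have hm : Measurable fstar := hfstarC1.continuous.measurable
  have hmp := measurePreserving_graphReflection hm
  have hemb := measurableEmbedding_graphReflection hm
  have hint := integrable_weighted_energy k (hv.of_le (by exact_mod_cast le_top)) hv'
  set G : EuclideanSpace ℝ (Fin d) × ℝ → ℝ := fun p =>
    k ^ 2 * ‖v p‖ ^ 2 +
      ((∑ i : Fin d, ‖fderiv ℝ v p (EuclideanSpace.single i 1, (0 : ℝ))‖ ^ 2) +
        ‖fderiv ℝ v p ((0 : EuclideanSpace ℝ (Fin d)), (1 : ℝ))‖ ^ 2) with hG
  have hlip : LipschitzWith L.toNNReal fstar := LipschitzWith.of_dist_le_mul fun x y => by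
    rw [Real.dist_eq, dist_eq_norm, Real.coe_toNNReal _ hL.le]
    exact hfstar x y
  have hDL : ∀ x, ‖fderiv ℝ fstar x‖ ≤ L := fun x => by
    simpa [hL.le] using norm_fderiv_le_of_lipschitz ℝ hlip (x₀ := x)
  set C : ℝ := 4 * (1 + 4 * d * L ^ 2)
  have hdL : 0 ≤ (d : ℝ) * L ^ 2 := by positivity
  set T : Set (EuclideanSpace ℝ (Fin d) × ℝ) :=
    {q | fstar q.1 < q.2 ∧ q.2 < 2 * fstar q.1 - f q.1}
  have hR : {p : EuclideanSpace ℝ (Fin d) × ℝ | f p.1 < p.2 ∧ p.2 < fstar p.1} =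
      graphReflection fstar ⁻¹' T := by
    ext p
    simp only [graphReflection, Set.mem_preimage, Set.mem_ofPred_eq, T]
    constructor <;> rintro ⟨h₁, h₂⟩ <;> constructor <;> linarith
  have hTS : T ⊆ {p : EuclideanSpace ℝ (Fin d) × ℝ | fstar p.1 < p.2 ∧ p.2 < H} :=
    fun q hq => ⟨hq.1, hq.2.trans (hlt q.1)⟩
  have hintE : Integrable fun p => C * G (graphReflection fstar p) :=
    ((hmp.integrable_comp_emb hemb).2 hint).const_mul C
  calc _ ≤ ∫ p in graphReflection fstar ⁻¹' T, C * G (graphReflection fstar p) := by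
        rw [hR]
        refine integral_mono_of_nonneg (ae_of_all _ fun p => by positivity)
          hintE.integrableOn (ae_of_all _ fun p => ?_)
        have hgrad := gradient_sq_comp_graphReflection_le (p := p)
          (hfstarC1.differentiable one_ne_zero p.1) (hDL p.1)
          (hv.differentiable (by simp) (graphReflection fstar p))
        simp only [hG, C, Function.comp_apply]
        set A := ∑ i : Fin d, ‖fderiv ℝ v (graphReflection fstar p)
          (EuclideanSpace.single i 1, (0 : ℝ))‖ ^ 2
        set B := ‖fderiv ℝ v (graphReflection fstar p)
          ((0 : EuclideanSpace ℝ (Fin d)), (1 : ℝ))‖ ^ 2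
        set K := k ^ 2 * ‖v (graphReflection fstar p)‖ ^ 2
        have hA : 0 ≤ A := by positivity
        have hB : 0 ≤ B := by positivity
        have hK : 0 ≤ K := by positivity
        nlinarith [mul_nonneg hdL hA, mul_nonneg hdL hB, mul_nonneg hdL hK]
    _ = C * ∫ q in T, G q := by
        rw [hmp.setIntegral_preimage_emb hemb (fun q => C * G q) T, integral_const_mul]
    _ ≤ _ := by
        refine mul_le_mul_of_nonneg_left ?_ (by positivity)
        exact setIntegral_mono_set hint.integrableOn
          (ae_of_all _ fun p => by simp only [hG, Pi.zero_apply]; positivity) hTS.eventuallyLE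
end

section
/- Collar trace inequality: Let ε > 0 and suppose f is in addition bounded. Set 𝒞 = {(x̃, x_n) : f(x̃) − ε ≤ x_n ≤ f(x̃) + ε}. Then for every smooth compactly supported w : ℝ^{d+1} → ℂ, ε · ∫_{ℝ^d} |w(x̃, f(x̃))|² J_f(x̃) dx̃ ≤ √(1 + L²) · ( ε² · ∫_𝒞 |∂w/∂x_n(x)|² dx + ∫_𝒞 |w(x)|² dx ). -/
open MeasureTheory

/-- One-sided trace inequality on an interval of length `ε`. -/
theorem mul_norm_sq_le_integral_of_hasDerivAt {u u' : ℝ → ℂ} {ε : ℝ} (hε : 0 < ε)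
    (hu : ∀ t, HasDerivAt u (u' t) t) (hu' : Continuous u') :
    ε * ‖u 0‖ ^ 2 ≤ ∫ t in (0 : ℝ)..ε, (2 * ‖u t‖ ^ 2 + ε ^ 2 * ‖u' t‖ ^ 2) := by
  have hc : Continuous u := continuous_iff_continuousAt.2 fun t => (hu t).continuousAt
  have hderiv : ∀ t, HasDerivAt (fun t => (t - ε) * ‖u t‖ ^ 2)
      (1 * ‖u t‖ ^ 2 + (t - ε) * (2 * inner ℝ (u t) (u' t))) t := fun t =>
    ((hasDerivAt_id t).sub_const ε).mul (hu t).norm_sq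
  have hcont : Continuous
      fun t => 1 * ‖u t‖ ^ 2 + (t - ε) * (2 * inner ℝ (u t) (u' t)) := by fun_prop
  have hftc := intervalIntegral.integral_eq_sub_of_hasDerivAt
    (fun t _ => hderiv t) (hcont.intervalIntegrable 0 ε)
  have heq : ε * ‖u 0‖ ^ 2 =
      ∫ t in (0 : ℝ)..ε, (1 * ‖u t‖ ^ 2 + (t - ε) * (2 * inner ℝ (u t) (u' t))) := by
    rw [hftc]; ring
  rw [heq]
  refine intervalIntegral.integral_mono_on hε.le (hcont.intervalIntegrable 0 ε)
    (Continuous.intervalIntegrable (by fun_prop) 0 ε) fun t ht => ?_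
  have hin := abs_real_inner_le_norm (u t) (u' t)
  have hmul : (t - ε) * inner ℝ (u t) (u' t) ≤ ε * (‖u t‖ * ‖u' t‖) := by
    refine (le_abs_self _).trans ?_
    rw [abs_mul]
    refine mul_le_mul ?_ hin (abs_nonneg _) hε.le
    rw [abs_le]
    constructor <;> linarith [ht.1, ht.2]
  nlinarith [sq_nonneg (‖u t‖ - ε * ‖u' t‖)]

/-- Trace inequality at the midpoint `c` of an interval of half-length `ε`. -/
theorem mul_norm_sq_le_integral_Icc_of_hasDerivAt {u u' : ℝ → ℂ} {ε : ℝ} (hε : 0 < ε) (c : ℝ)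
    (hu : ∀ t, HasDerivAt u (u' t) t) (hu' : Continuous u') :
    ε * ‖u c‖ ^ 2 ≤ ε ^ 2 * (∫ t in Set.Icc (c - ε) (c + ε), ‖u' t‖ ^ 2)
      + ∫ t in Set.Icc (c - ε) (c + ε), ‖u t‖ ^ 2 := by
  have hc : Continuous u := continuous_iff_continuousAt.2 fun t => (hu t).continuousAt
  have hright := mul_norm_sq_le_integral_of_hasDerivAt hε
    (u := fun t => u (c + t)) (u' := fun t => u' (c + t))
    (fun t => (hu (c + t)).comp_const_add c t) (by fun_prop)
  have hleft := mul_norm_sq_le_integral_of_hasDerivAt hε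
    (u := fun t => u (c - t)) (u' := fun t => -u' (c - t))
    (fun t => (hu (c - t)).comp_const_sub c t) (by fun_prop)
  simp only [norm_neg, add_zero, sub_zero] at hright hleft
  rw [intervalIntegral.integral_comp_add_left
    (fun t => 2 * ‖u t‖ ^ 2 + ε ^ 2 * ‖u' t‖ ^ 2) c, add_zero] at hright
  rw [intervalIntegral.integral_comp_sub_left
    (fun t => 2 * ‖u t‖ ^ 2 + ε ^ 2 * ‖u' t‖ ^ 2) c, sub_zero] at hleft
  have hI : ∀ a b, IntervalIntegrable (fun t => 2 * ‖u t‖ ^ 2 + ε ^ 2 * ‖u' t‖ ^ 2)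
      volume a b := fun a b => Continuous.intervalIntegrable (by fun_prop) a b
  have hsum := intervalIntegral.integral_add_adjacent_intervals
    (hI (c - ε) c) (hI c (c + ε))
  rw [intervalIntegral.integral_add (a := c - ε) (b := c + ε)
    (Continuous.intervalIntegrable (by fun_prop) _ _)
    (Continuous.intervalIntegrable (by fun_prop) _ _), intervalIntegral.integral_const_mul,
    intervalIntegral.integral_const_mul] at hsum
  simp only [integral_Icc_eq_integral_Ioc]
  rw [← intervalIntegral.integral_of_le (by linarith),
    ← intervalIntegral.integral_of_le (by linarith)]
  have hpos : 0 ≤ ε ^ 2 * ∫ t in (c - ε)..(c + ε), ‖u' t‖ ^ 2 :=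
    mul_nonneg (sq_nonneg ε)
      (intervalIntegral.integral_nonneg (by linarith) fun t _ => sq_nonneg _)
  linarith

/-- **Collar trace inequality.** Let `f : ℝ^d → ℝ` be a bounded Lipschitz function with
constant `L`, `ε > 0`, and `𝒞 = {(x̃,x_n) : f(x̃) − ε ≤ x_n ≤ f(x̃) + ε}` the collar of
half-height `ε` around the graph of `f`.  Then for every smooth compactly supported
`w : ℝ^{d+1} → ℂ`,
`ε ∫ |w(x̃,f(x̃))|² J_f(x̃) dx̃ ≤ √(1+L²)(ε² ∫_𝒞 |∂w/∂x_n|² + ∫_𝒞 |w|²)`,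
where `J_f = √(1+|∇f|²)`. -/
theorem collar_trace_inequality
    (d : ℕ) (hd : 1 ≤ d) (L ε : ℝ) (hL : 0 < L) (hε : 0 < ε)
    (f : EuclideanSpace ℝ (Fin d) → ℝ)
    (hf : ∀ x y : EuclideanSpace ℝ (Fin d), |f x - f y| ≤ L * ‖x - y‖)
    (hbdd : ∃ M : ℝ, ∀ x : EuclideanSpace ℝ (Fin d), |f x| ≤ M)
    (w : EuclideanSpace ℝ (Fin d) × ℝ → ℂ)
    (hw : ContDiff ℝ (⊤ : ℕ∞) w) (hw' : HasCompactSupport w) :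
    ε * ∫ x : EuclideanSpace ℝ (Fin d),
        ‖w (x, f x)‖ ^ 2 * Real.sqrt (1 + ‖fderiv ℝ f x‖ ^ 2)
      ≤ Real.sqrt (1 + L ^ 2) *
        (ε ^ 2 *
            (∫ p in {p : EuclideanSpace ℝ (Fin d) × ℝ | f p.1 - ε ≤ p.2 ∧ p.2 ≤ f p.1 + ε},
              ‖fderiv ℝ w p ((0 : EuclideanSpace ℝ (Fin d)), (1 : ℝ))‖ ^ 2)
          + ∫ p in {p : EuclideanSpace ℝ (Fin d) × ℝ | f p.1 - ε ≤ p.2 ∧ p.2 ≤ f p.1 + ε},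
              ‖w p‖ ^ 2) := by
  have hlip : LipschitzWith ⟨L, hL.le⟩ f := LipschitzWith.of_dist_le_mul fun x y => by
    rw [Real.dist_eq, dist_eq_norm]; exact hf x y
  have hfc : Continuous f := hlip.continuous
  have hwc : Continuous w := hw.continuous
  set C := {p : EuclideanSpace ℝ (Fin d) × ℝ | f p.1 - ε ≤ p.2 ∧ p.2 ≤ f p.1 + ε}
  have hCm : MeasurableSet C := by
    have hlow : MeasurableSet {p : EuclideanSpace ℝ (Fin d) × ℝ | f p.1 - ε ≤ p.2} :=
      measurableSet_le (by fun_prop) (by fun_prop)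
    have hupp : MeasurableSet {p : EuclideanSpace ℝ (Fin d) × ℝ | p.2 ≤ f p.1 + ε} :=
      measurableSet_le (by fun_prop) (by fun_prop)
    exact hlow.inter hupp
  set D : EuclideanSpace ℝ (Fin d) × ℝ → ℂ :=
    fun p => fderiv ℝ w p ((0 : EuclideanSpace ℝ (Fin d)), (1 : ℝ))
  have hDc : Continuous D := (hw.continuous_fderiv (by simp)).clm_apply continuous_const
  have hDs : HasCompactSupport D := hw'.fderiv_apply ℝ _
  have hint : ∀ g : EuclideanSpace ℝ (Fin d) × ℝ → ℂ, Continuous g → HasCompactSupport g →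
      Integrable (C.indicator fun p => ‖g p‖ ^ 2) (volume.prod volume) := fun g hg hgs => by
    rw [← Measure.volume_eq_prod]
    exact ((by fun_prop : Continuous fun p => ‖g p‖ ^ 2).integrable_of_hasCompactSupport
      (hgs.comp_left (g := fun z : ℂ => ‖z‖ ^ 2) (by simp))).indicator hCm
  have hslice : ∀ (g : EuclideanSpace ℝ (Fin d) × ℝ → ℂ) x,
      ∫ t, C.indicator (fun p => ‖g p‖ ^ 2) (x, t) =
        ∫ t in Set.Icc (f x - ε) (f x + ε), ‖g (x, t)‖ ^ 2 := fun g x => by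
    rw [← integral_indicator measurableSet_Icc]
    rfl
  rw [← integral_indicator hCm, ← integral_indicator hCm, Measure.volume_eq_prod,
    integral_prod _ (hint D hDc hDs), integral_prod _ (hint w hwc hw'),
    ← integral_const_mul, ← integral_const_mul, ← integral_add
      ((hint D hDc hDs).integral_prod_left.const_mul _) (hint w hwc hw').integral_prod_left,
    ← integral_const_mul]
  refine integral_mono_of_nonneg (Filter.Eventually.of_forall fun x => by positivity)
    ((((hint D hDc hDs).integral_prod_left.const_mul _).add
      (hint w hwc hw').integral_prod_left).const_mul _) (Filter.Eventually.of_forall fun x => ?_)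
  simp only [hslice]
  have htrace := mul_norm_sq_le_integral_Icc_of_hasDerivAt hε (f x)
    (u := fun t => w (x, t)) (u' := fun t => D (x, t))
    (fun t => ((hw.differentiable (by simp)) (x, t)).hasFDerivAt.comp_hasDerivAt t
      ((hasDerivAt_const t x).prodMk (hasDerivAt_id t))) (by fun_prop)
  have hJ : Real.sqrt (1 + ‖fderiv ℝ f x‖ ^ 2) ≤ Real.sqrt (1 + L ^ 2) := by
    have hfd : ‖fderiv ℝ f x‖ ≤ L := norm_fderiv_le_of_lipschitz ℝ hlip
    gcongr
  calc ε * (‖w (x, f x)‖ ^ 2 * Real.sqrt (1 + ‖fderiv ℝ f x‖ ^ 2))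
      = Real.sqrt (1 + ‖fderiv ℝ f x‖ ^ 2) * (ε * ‖w (x, f x)‖ ^ 2) := by ring
    _ ≤ _ := mul_le_mul hJ htrace (by positivity) (by positivity)
end
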